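/- Let 0 < a ≤ 1/2 and let Q : [0,1] → [0,1] be nondecreasing with Q(1−a) ≤ 2·Q(a). Then ∫_0^1 t·Q(t) dt ≤ (4/3)·[ (1/(4a²))·∫_0^a t·Q(t) dt + (1/2)·∫_a^{1−a} Q(t) dt + ∫_{1−a}^1 (1 − (1−t)/(2a))·Q(t) dt ]. -/

import Mathlib

open MeasureTheory Set intervalIntegral

theorem integral_quadratic (u v p q r : ℝ) :
    ∫ t in u..v, (p + q * t + r * t ^ 2) =
      p * (v - u) + q * (v ^ 2 - u ^ 2) / 2 + r * (v ^ 3 - u ^ 3) / 3 := by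
  have h : ∀ t ∈ Set.uIcc u v,
      HasDerivAt (fun t : ℝ => p * t + q * t ^ 2 / 2 + r * t ^ 3 / 3)
        (p + q * t + r * t ^ 2) t := by
    intro t _
    have h1 := (hasDerivAt_id t).const_mul p
    have h2 := (((hasDerivAt_pow 2 t).const_mul q).div_const 2)
    have h3 := (((hasDerivAt_pow 3 t).const_mul r).div_const 3)
    refine ((h1.add h2).add h3).congr_deriv ?_
    norm_num
    ring
  rw [intervalIntegral.integral_eq_sub_of_hasDerivAt h
    (Continuous.intervalIntegrable (by fun_prop) _ _)]
  ring

/-- A function with values in `[L, 2 L]`, integrated against `2/3 - t` over an interval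
symmetric about `1/2`. -/
theorem integral_two_thirds_sub_mul_nonneg {a L : ℝ} {Q : ℝ → ℝ} (ha0 : 0 ≤ a) (ha : a ≤ 1 / 2)
    (hL : 0 ≤ L) (hQ : ∀ t ∈ Set.Icc a (1 - a), Q t ∈ Set.Icc L (2 * L))
    (hint : IntervalIntegrable (fun t => (2 / 3 - t) * Q t) volume a (1 - a)) :
    0 ≤ ∫ t in a..(1 - a), (2 / 3 - t) * Q t := by
  have hpt : ∀ t ∈ Set.Icc a (1 - a),
      L * (7 / 12) + -(L / 2) * t + -(3 * L / 4) * t ^ 2 ≤ (2 / 3 - t) * Q t := by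
    intro t ht
    obtain ⟨h1, h2⟩ := hQ t ht
    rcases le_total t (2 / 3) with h | h
    · nlinarith [mul_nonneg (sub_nonneg.2 h) (sub_nonneg.2 h1),
        mul_nonneg hL (sq_nonneg (t - 1 / 3))]
    · nlinarith [mul_nonneg (sub_nonneg.2 h) (sub_nonneg.2 h2),
        mul_nonneg hL (sq_nonneg (t - 1))]
  refine le_trans ?_ (intervalIntegral.integral_mono_on (by linarith)
    (Continuous.intervalIntegrable (by fun_prop) _ _) hint hpt)
  rw [integral_quadratic]
  have hf : 0 ≤ L * ((1 - 2 * a) * (1 - (1 - 2 * a) ^ 2 + 8 / 9)) :=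
    mul_nonneg hL (mul_nonneg (by linarith) (by nlinarith))
  nlinarith

/-- If an increasing linear weight has nonnegative integral over `[u, v]`, so does its product
with a nonnegative monotone function. -/
theorem integral_linear_mul_nonneg {u v p q : ℝ} {Q : ℝ → ℝ} (huv : u ≤ v) (hq : 0 < q)
    (hv : 0 ≤ p + q * v) (hw : 0 ≤ ∫ t in u..v, (p + q * t))
    (hQ : MonotoneOn Q (Set.Icc u v)) (hQ0 : ∀ t ∈ Set.Icc u v, 0 ≤ Q t)
    (hint : IntervalIntegrable (fun t => (p + q * t) * Q t) volume u v) :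
    0 ≤ ∫ t in u..v, (p + q * t) * Q t := by
  obtain ⟨c, hc, hlo, hhi⟩ : ∃ c ∈ Set.Icc u v,
      (∀ t ∈ Set.Icc u v, t < c → p + q * t ≤ 0) ∧
      (∀ t ∈ Set.Icc u v, c ≤ t → 0 ≤ p + q * t) := by
    rcases le_total 0 (p + q * u) with h | h
    · exact ⟨u, ⟨le_rfl, huv⟩, fun t ht htu => absurd ht.1 (not_le.2 htu),
        fun t ht _ => by nlinarith [ht.1]⟩
    · have hc : q * (-p / q) = -p := by field_simp
      exact ⟨-p / q, ⟨by nlinarith, by nlinarith⟩, fun t _ h => by nlinarith,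
        fun t _ h => by nlinarith⟩
  have hpt : ∀ t ∈ Set.Icc u v, (p + q * t) * Q c ≤ (p + q * t) * Q t := by
    intro t ht
    rcases lt_or_ge t c with h | h
    · exact mul_le_mul_of_nonpos_left (hQ ht hc h.le) (hlo t ht h)
    · exact mul_le_mul_of_nonneg_left (hQ hc ht h) (hhi t ht h)
  refine le_trans ?_ (intervalIntegral.integral_mono_on huv
    (Continuous.intervalIntegrable (by fun_prop) _ _) hint hpt)
  rw [intervalIntegral.integral_mul_const]
  exact mul_nonneg hw (hQ0 c hc)



/-- Analytic form of the 4/3 price-of-anarchy bound for the two-stage early-contracting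
game with uniform school ability distributions and fully informative grading: for the
truthful nondecreasing mapping `Q : [0,1] → [0,1]` with `Q (1-a) ≤ 2·Q a`, the optimal
welfare `∫_0^1 t·Q t dt` is at most `4/3` times the equilibrium welfare. -/
theorem stmt_13
    (a : ℝ) (ha0 : 0 < a) (ha : a ≤ 1/2)
    (Q : ℝ → ℝ)
    (hQmono : MonotoneOn Q (Set.Icc (0:ℝ) 1))
    (hQmap : Set.MapsTo Q (Set.Icc (0:ℝ) 1) (Set.Icc (0:ℝ) 1))
    (hQbc : Q (1 - a) ≤ 2 * Q a) :
    (∫ t in (0:ℝ)..1, t * Q t) ≤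
      4/3 * (1 / (4 * a ^ 2) * (∫ t in (0:ℝ)..a, t * Q t)
        + 1/2 * (∫ t in a..(1 - a), Q t)
        + ∫ t in (1 - a)..1, (1 - (1 - t) / (2 * a)) * Q t) := by
  have hsub : ∀ {u v : ℝ}, 0 ≤ u → u ≤ v → v ≤ 1 → ∀ {f : ℝ → ℝ}, Continuous f →
      IntervalIntegrable (fun t => f t * Q t) volume u v := by
    intro u v hu huv hv f hf
    refine IntervalIntegrable.continuousOn_mul (MonotoneOn.intervalIntegrable ?_) hf.continuousOn
    rw [Set.uIcc_of_le huv]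
    exact hQmono.mono (Set.Icc_subset_Icc hu hv)
  have hmem : a ∈ Set.Icc (0 : ℝ) 1 := ⟨by linarith, by linarith⟩
  have hmem' : 1 - a ∈ Set.Icc (0 : ℝ) 1 := ⟨by linarith, by linarith⟩
  have hA := hsub (u := 0) (v := a) le_rfl ha0.le (by linarith) continuous_id
  have hB := hsub (u := a) (v := 1 - a) ha0.le (by linarith) (by linarith) continuous_id
  have hC := hsub (u := 1 - a) (v := 1) (by linarith) (by linarith) le_rfl continuous_id
  simp only [id] at hA hB hC
  have hbottom : 0 ≤ ∫ t in (0 : ℝ)..a, t * Q t :=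
    intervalIntegral.integral_nonneg ha0.le fun t ht =>
      mul_nonneg ht.1 (hQmap ⟨ht.1, by linarith [ht.2]⟩).1
  have hcoef : 1 ≤ 4 / 3 * (1 / (4 * a ^ 2)) := by
    rw [← mul_div_assoc, le_div_iff₀ (by positivity)]
    nlinarith
  have hmid : 0 ≤ ∫ t in a..(1 - a), (2 / 3 - t) * Q t := by
    refine integral_two_thirds_sub_mul_nonneg ha0.le ha (hQmap hmem).1 (fun t ht => ?_)
      (hsub ha0.le (by linarith) (by linarith) (by fun_prop))
    have htm : t ∈ Set.Icc (0 : ℝ) 1 := ⟨by linarith [ht.1], by linarith [ht.2]⟩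
    exact ⟨hQmono hmem htm ht.1, (hQmono htm hmem' ht.2).trans hQbc⟩
  have hslope : 0 < 2 / (3 * a) - 1 := by
    rw [sub_pos, lt_div_iff₀ (by positivity)]
    linarith
  have htop : 0 ≤ ∫ t in (1 - a)..1,
      ((4 / 3 - 2 / (3 * a)) + (2 / (3 * a) - 1) * t) * Q t := by
    refine integral_linear_mul_nonneg (by linarith) hslope (by linarith) ?_
      (hQmono.mono (Set.Icc_subset_Icc (by linarith) le_rfl))
      (fun t ht => (hQmap ⟨by linarith [ht.1], ht.2⟩).1)
      (hsub (by linarith) (by linarith) le_rfl (by fun_prop))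
    have h := integral_quadratic (1 - a) 1 (4 / 3 - 2 / (3 * a)) (2 / (3 * a) - 1) 0
    simp only [zero_mul, add_zero, zero_div] at h
    rw [h]
    have : (4 / 3 - 2 / (3 * a)) * (1 - (1 - a))
        + (2 / (3 * a) - 1) * (1 ^ 2 - (1 - a) ^ 2) / 2 = a ^ 2 / 2 := by
      field_simp
      ring
    rw [this]
    positivity
  have hmid_eq : ∫ t in a..(1 - a), (2 / 3 - t) * Q t
      = 2 / 3 * (∫ t in a..(1 - a), Q t) - ∫ t in a..(1 - a), t * Q t := by
    rw [← intervalIntegral.integral_const_mul, ← intervalIntegral.integral_sub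
      (hsub ha0.le (by linarith) (by linarith) continuous_const) hB]
    simp only [sub_mul]
  have htop_eq : ∫ t in (1 - a)..1, ((4 / 3 - 2 / (3 * a)) + (2 / (3 * a) - 1) * t) * Q t
      = 4 / 3 * (∫ t in (1 - a)..1, (1 - (1 - t) / (2 * a)) * Q t)
        - ∫ t in (1 - a)..1, t * Q t := by
    rw [← intervalIntegral.integral_const_mul, ← intervalIntegral.integral_sub
      ((hsub (by linarith) (by linarith) le_rfl (by fun_prop)).const_mul _) hC]
    congr 1
    ext t
    field_simp
    ring
  rw [← intervalIntegral.integral_add_adjacent_intervals (hA.trans hB) hC,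
    ← intervalIntegral.integral_add_adjacent_intervals hA hB]
  nlinarith [mul_le_mul_of_nonneg_right hcoef hbottom]
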